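/- ∑_{k=0}^∞ (1/2)_k^3 / (k!)^3 · (6k+1)/4^k = 4/π. -/

import Mathlib

/-- The Pochhammer symbol `(x)ₖ = x (x+1) ⋯ (x+k-1)`, with `(x)₀ = 1`. -/
noncomputable def poch (x : ℝ) (k : ℕ) : ℝ :=
  ∏ i ∈ Finset.range k, (x + i)

open Filter Topology

lemma poch_succ (x : ℝ) (n : ℕ) : poch x (n + 1) = poch x n * (x + n) :=
  Finset.prod_range_succ _ _

/-- The normalized central binomial coefficient `(1/2)ₙ / n!`. -/
noncomputable def halfRatio (n : ℕ) : ℝ := poch (1 / 2) n / n.factorial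

lemma halfRatio_zero : halfRatio 0 = 1 := by simp [halfRatio, poch]

lemma halfRatio_succ (n : ℕ) :
    halfRatio (n + 1) = halfRatio n * ((2 * n + 1) / (2 * n + 2)) := by
  have := Nat.factorial_ne_zero n
  simp only [halfRatio, poch_succ, Nat.factorial_succ]
  push_cast
  field_simp
  ring

lemma halfRatio_pos (n : ℕ) : 0 < halfRatio n := by
  induction n with
  | zero => simp [halfRatio_zero]
  | succ n ih => rw [halfRatio_succ]; positivity

lemma halfRatio_le_one (n : ℕ) : halfRatio n ≤ 1 := by
  induction n with
  | zero => simp [halfRatio_zero]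
  | succ n ih =>
    rw [halfRatio_succ]
    refine mul_le_one₀ ih (by positivity) ?_
    rw [div_le_one (by positivity)]
    linarith

lemma halfRatio_sq_mul_wallis (n : ℕ) :
    halfRatio n ^ 2 * (2 * n + 1) * Real.Wallis.W n = 1 := by
  induction n with
  | zero => simp [halfRatio_zero, Real.Wallis.W]
  | succ n ih =>
    rw [halfRatio_succ, Real.Wallis.W_succ]
    refine Eq.trans ?_ ih
    push_cast
    field_simp
    ring

lemma halfRatio_sq_mul_le (n : ℕ) : halfRatio n ^ 2 * (2 * n + 1) ≤ 1 := by
  induction n with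
  | zero => simp [halfRatio_zero]
  | succ n ih =>
    refine le_trans (le_of_eq ?_) (mul_le_one₀ ih
      (b := (2 * n + 1) * (2 * n + 3) / (2 * n + 2 : ℝ) ^ 2) (by positivity) ?_)
    · rw [halfRatio_succ]
      push_cast
      field_simp
      ring
    · rw [div_le_one (by positivity)]
      nlinarith

lemma tendsto_halfRatio_sq : Tendsto (fun n => halfRatio n ^ 2) atTop (𝓝 0) := by
  refine squeeze_zero (fun n => by positivity) (fun n => ?_)
    (tendsto_one_div_add_atTop_nhds_zero_nat (𝕜 := ℝ))
  rw [le_div_iff₀ (by positivity)]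
  have := halfRatio_sq_mul_le n
  have : 0 ≤ halfRatio n ^ 2 * n := by positivity
  linarith

lemma tendsto_halfRatio_sq_mul :
    Tendsto (fun k : ℕ => halfRatio k ^ 2 * (4 * k + 1)) atTop (𝓝 (4 / Real.pi)) := by
  have h := ((Real.Wallis.tendsto_W_nhds_pi_div_two.inv₀ (by positivity)).const_mul 2).sub
    tendsto_halfRatio_sq
  convert h using 2 with k
  · rw [← eq_inv_of_mul_eq_one_left (halfRatio_sq_mul_wallis k)]
    ring
  · field_simp
    ring

/-- The hypergeometric factor of the Wilf–Zeilberger pair. -/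
noncomputable def wzKernel (k n : ℕ) : ℝ :=
  halfRatio k ^ 2 * halfRatio n ^ 3 / ((n + k).choose k : ℝ) ^ 2 / 4 ^ n

/-- The summand whose sum over `n` does not depend on `k`. -/
noncomputable def wzTerm (k n : ℕ) : ℝ := wzKernel k n * (6 * n + 4 * k + 1)

lemma choose_add_pos (k n : ℕ) : 0 < ((n + k).choose k : ℝ) := by
  exact_mod_cast Nat.choose_pos (Nat.le_add_left k n)

lemma wzKernel_nonneg (k n : ℕ) : 0 ≤ wzKernel k n := by
  have := halfRatio_pos n
  unfold wzKernel
  positivity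

lemma wzKernel_succ_left (k n : ℕ) :
    wzKernel (k + 1) n = wzKernel k n * ((2 * k + 1) / (2 * (n + k + 1))) ^ 2 := by
  have h : ((n + (k + 1)).choose (k + 1) : ℝ) = (n + k).choose k * ((n + k + 1) / (k + 1)) := by
    have := Nat.add_one_mul_choose_eq (n + k) k
    rw [← mul_div_assoc, eq_div_iff (by positivity), mul_comm ((n + k).choose k : ℝ)]
    exact_mod_cast this.symm
  have := choose_add_pos k n
  simp only [wzKernel, halfRatio_succ, h]
  field_simp

lemma wzKernel_succ_right (k n : ℕ) :
    wzKernel k (n + 1) =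
      wzKernel k n * ((2 * n + 1) ^ 3 / (32 * (n + 1) * (n + k + 1) ^ 2)) := by
  have h : ((n + 1 + k).choose k : ℝ) = (n + k).choose k * ((n + k + 1) / (n + 1)) := by
    have := Nat.add_one_mul_choose_eq (n + k) n
    rw [← mul_div_assoc, eq_div_iff (by positivity), mul_comm ((n + k).choose k : ℝ),
      ← Nat.choose_symm_add, ← Nat.choose_symm_add, add_right_comm n 1 k]
    exact_mod_cast this.symm
  have := choose_add_pos k n
  simp only [wzKernel, halfRatio_succ, h]
  field_simp
  ring

lemma wzTerm_succ_sub (k n : ℕ) :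
    wzTerm (k + 1) n - wzTerm k n =
      8 * (n + 1 : ℕ) * wzKernel k (n + 1) - 8 * n * wzKernel k n := by
  simp only [wzTerm, wzKernel_succ_left, wzKernel_succ_right]
  push_cast
  field_simp
  ring

lemma wzKernel_le (k n : ℕ) : wzKernel k n ≤ halfRatio k ^ 2 / 4 ^ n := by
  have h1 : (1 : ℝ) ≤ (n + k).choose k := by
    exact_mod_cast Nat.choose_pos (Nat.le_add_left k n)
  have := halfRatio_pos n
  unfold wzKernel
  gcongr
  refine (div_le_self (by positivity) (one_le_pow₀ h1)).trans ?_
  exact mul_le_of_le_one_right (by positivity) (pow_le_one₀ this.le (halfRatio_le_one n))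

lemma wzTerm_nonneg (k n : ℕ) : 0 ≤ wzTerm k n :=
  mul_nonneg (wzKernel_nonneg k n) (by positivity)

lemma wzTerm_le (k n : ℕ) : wzTerm k n ≤ 2 * ((6 * n + 1) * (1 / 4) ^ n) := by
  have h := halfRatio_sq_mul_le k
  calc wzTerm k n ≤ halfRatio k ^ 2 / 4 ^ n * ((2 * (2 * k + 1)) * (6 * n + 1)) := by
        refine mul_le_mul (wzKernel_le k n) ?_ (by positivity) (by positivity)
        have : (0 : ℝ) ≤ k * n := by positivity
        nlinarith
    _ = (halfRatio k ^ 2 * (2 * k + 1)) * (2 * ((6 * n + 1) * (1 / 4) ^ n)) := by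
        rw [one_div_pow]; ring
    _ ≤ _ := mul_le_of_le_one_left (by positivity) h

lemma summable_linear_mul_geometric :
    Summable fun n : ℕ => 2 * ((6 * n + 1) * (1 / 4 : ℝ) ^ n) := by
  have h1 := summable_pow_mul_geometric_of_norm_lt_one (R := ℝ) 1 (r := 1 / 4) (by norm_num)
  have h0 := summable_pow_mul_geometric_of_norm_lt_one (R := ℝ) 0 (r := 1 / 4) (by norm_num)
  refine (((h1.mul_left 6).add h0).mul_left 2).congr fun n => ?_
  ring

lemma summable_wzTerm (k : ℕ) : Summable (wzTerm k) :=
  summable_linear_mul_geometric.of_nonneg_of_le (wzTerm_nonneg k) (wzTerm_le k)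

lemma tendsto_mul_wzKernel (k : ℕ) :
    Tendsto (fun n : ℕ => 8 * n * wzKernel k n) atTop (𝓝 0) := by
  have h := ((summable_wzTerm k).tendsto_atTop_zero).const_mul 2
  rw [mul_zero] at h
  refine squeeze_zero (fun n => mul_nonneg (by positivity) (wzKernel_nonneg k n)) (fun n => ?_) h
  have : 0 ≤ wzKernel k n * (4 * n + 8 * k + 2) :=
    mul_nonneg (wzKernel_nonneg k n) (by positivity)
  unfold wzTerm
  linarith

lemma tsum_wzTerm_succ (k : ℕ) : ∑' n, wzTerm (k + 1) n = ∑' n, wzTerm k n := by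
  have h := ((summable_wzTerm (k + 1)).hasSum.sub (summable_wzTerm k).hasSum).tendsto_sum_nat
  simp only [wzTerm_succ_sub] at h
  simp only [Finset.sum_range_sub (fun n : ℕ => 8 * (n : ℝ) * wzKernel k n)] at h
  have h0 := tendsto_mul_wzKernel k
  refine sub_eq_zero.1 (tendsto_nhds_unique h ?_)
  simpa using h0

lemma tsum_wzTerm (k : ℕ) : ∑' n, wzTerm k n = ∑' n, wzTerm 0 n := by
  induction k with
  | zero => rfl
  | succ k ih => rw [tsum_wzTerm_succ, ih]

lemma tendsto_wzTerm_zero :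
    Tendsto (fun k => wzTerm k 0) atTop (𝓝 (4 / Real.pi)) := by
  refine tendsto_halfRatio_sq_mul.congr fun k => ?_
  simp [wzTerm, wzKernel, halfRatio_zero]

lemma tendsto_wzTerm_succ (n : ℕ) : Tendsto (fun k => wzTerm k (n + 1)) atTop (𝓝 0) := by
  have hlim : Tendsto (fun k : ℕ => wzTerm k n * (7 * (2 * n + 1) ^ 3 * (1 / ((k : ℝ) + 1))))
      atTop (𝓝 0) := by
    have h := ((tendsto_one_div_add_atTop_nhds_zero_nat (𝕜 := ℝ)).const_mul
      (7 * (2 * n + 1 : ℝ) ^ 3)).const_mul (2 * ((6 * n + 1) * (1 / 4 : ℝ) ^ n))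
    rw [mul_zero, mul_zero] at h
    refine squeeze_zero (fun k => mul_nonneg (wzTerm_nonneg k n) (by positivity)) (fun k => ?_) h
    exact mul_le_mul_of_nonneg_right (wzTerm_le k n) (by positivity)
  refine squeeze_zero (fun k => wzTerm_nonneg k _) (fun k => ?_) hlim
  unfold wzTerm
  rw [wzKernel_succ_right, mul_assoc, mul_assoc (wzKernel k n)]
  refine mul_le_mul_of_nonneg_left ?_ (wzKernel_nonneg k n)
  have h1 : ((n + 1 : ℕ) : ℝ) = n + 1 := by push_cast; ring
  have hn : (0 : ℝ) ≤ n := by positivity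
  have hk : (0 : ℝ) ≤ k := by positivity
  calc (2 * n + 1 : ℝ) ^ 3 / (32 * (n + 1) * (n + k + 1) ^ 2) * (6 * (n + 1 : ℕ) + 4 * k + 1)
      ≤ (2 * n + 1 : ℝ) ^ 3 / (k + 1) * (7 * (6 * n + 4 * k + 1)) := by
        rw [h1]
        gcongr
        · nlinarith [mul_nonneg hn hk]
        · linarith
    _ = _ := by ring

theorem ramanujan_first :
    ∑' k : ℕ, (poch (1/2) k ^ 3) / ((k.factorial : ℝ) ^ 3) * ((6*(k : ℝ) + 1) / (4 : ℝ) ^ k) = 4 / Real.pi := by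
  have h := tendsto_tsum_of_dominated_convergence (f := wzTerm)
    (g := fun n => if n = 0 then 4 / Real.pi else 0) summable_linear_mul_geometric
    (fun n => by
      cases n with
      | zero => simpa using tendsto_wzTerm_zero
      | succ n => simpa using tendsto_wzTerm_succ n)
    (.of_forall fun k n => by
      rw [Real.norm_of_nonneg (wzTerm_nonneg k n)]
      exact wzTerm_le k n)
  simp only [tsum_wzTerm, tsum_ite_eq] at h
  rw [← tendsto_nhds_unique tendsto_const_nhds h]
  refine tsum_congr fun n => ?_
  simp only [wzTerm, wzKernel, halfRatio, div_pow]
  simp [poch]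
  ring
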